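/- Let S be a positive semifield and X a set; write C X for the set of convex subsets of the module 𝕊X and, for a finitely supported Ω : 𝒫(𝕊X) → S, set α(Ω) = { μ^𝕊_X(F) | F ∈ c(Ω) }. Let ℬ be a finite set of finitely supported functions from C X to S (viewed as finitely supported functions 𝒫(𝕊X) → S vanishing off C X), and let 𝒜 = conv(ℬ) be the convex closure of ℬ in the module of finitely supported functions C X → S. Then ⋃_{Ω ∈ 𝒜} α(Ω) = conv(⋃_{Θ ∈ ℬ} α(Θ)), the right-hand convex closure being taken in the module 𝕊X. -/

import Mathlib

universe u

/-- The structure map of the free `S`-module (semimodule) monad on a left `S`-module `M`: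
`a(φ) = Σ_{x ∈ supp φ} φ(x) • x`. -/
noncomputable def structMap (S : Type*) (M : Type*) [Semiring S] [AddCommMonoid M]
    [Module S M] (φ : M →₀ S) : M :=
  φ.sum fun x s => s • x

/-- The convex closure of a subset `A` of a left `S`-module:
`conv(A) = { a(φ) | φ finitely supported, supp φ ⊆ A, Σ_x φ(x) = 1 }`. -/
def convClos (S : Type*) {M : Type*} [Semiring S] [AddCommMonoid M] [Module S M]
    (A : Set M) : Set M :=
  { m | ∃ φ : M →₀ S, ↑φ.support ⊆ A ∧ (φ.sum fun _ s => s) = 1 ∧ structMap S M φ = m }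

/-- A subset of a left `S`-module is convex if it equals its convex closure. -/
def IsConvex (S : Type*) {M : Type*} [Semiring S] [AddCommMonoid M] [Module S M]
    (A : Set M) : Prop :=
  convClos S A = A

/-- `c(Φ)`: the set of finitely supported functions of the form
`x ↦ Σ_{A ∈ supp Φ, u(A) = x} Φ(A)` for choice functions `u` with `u(A) ∈ A` on `supp Φ`. -/
noncomputable def choiceSet {S : Type*} {X : Type*} [Semiring S] (Φ : Set X →₀ S) :
    Set (X →₀ S) :=
  { φ | ∃ u : Set X → X, (∀ A ∈ Φ.support, u A ∈ A) ∧ φ = Finsupp.mapDomain u Φ }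

/-- The canonical weak distributive law `δ_X(Φ) = conv(c(Φ))`,
the convex closure being taken in the module `X →₀ S`. -/
noncomputable def deltaLaw (S : Type*) {X : Type*} [Semiring S] (Φ : Set X →₀ S) :
    Set (X →₀ S) :=
  convClos S (choiceSet Φ)

/-- `α_a(Φ) = { a(φ) | φ ∈ c(Φ) }`, where `a` is the structure map of the module `M`. -/
noncomputable def alphaMap (S : Type*) {M : Type*} [Semiring S] [AddCommMonoid M]
    [Module S M] (Φ : Set M →₀ S) : Set M :=
  structMap S M '' choiceSet Φ

/-- The Eilenberg–Moore style description of `δ_X(Φ)` via witnesses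
`ψ` finitely supported on `{(A, x) | x ∈ A}` such that
`Φ(A) = Σ_{x ∈ A} ψ(A,x)` for all `A` and `φ(x) = Σ_{A ∋ x} ψ(A,x)` for all `x`. -/
noncomputable def deltaEM (S : Type*) {X : Type*} [Semiring S] (Φ : Set X →₀ S) :
    Set (X →₀ S) :=
  { φ | ∃ ψ : (Set X × X) →₀ S,
      (∀ p ∈ ψ.support, p.2 ∈ p.1) ∧
      Finsupp.mapDomain Prod.fst ψ = Φ ∧
      Finsupp.mapDomain Prod.snd ψ = φ }

/-- The multiplication of the convex-powerset-of-semimodule monad: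
`μ(𝒜) = ⋃_{Ω ∈ 𝒜} α(Ω)`. -/
noncomputable def muC (S : Type*) {M : Type*} [Semiring S] [AddCommMonoid M] [Module S M]
    (𝒜 : Set (Set M →₀ S)) : Set M :=
  ⋃ Ω ∈ 𝒜, alphaMap S Ω

/-- The Kleisli extension `g♯` of `g : Y → C Z`:
`g♯(𝒜) = ⋃_{φ ∈ 𝒜} { Σ_{y ∈ supp φ} φ(y) • ψ_y | ψ_y ∈ g(y) }`. -/
noncomputable def kleisliExt {S : Type*} {Y Z : Type*} [Semiring S]
    (g : Y → Set (Z →₀ S)) (𝒜 : Set (Y →₀ S)) : Set (Z →₀ S) :=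
  ⋃ φ ∈ 𝒜, { χ | ∃ ψ : Y → (Z →₀ S), (∀ y ∈ φ.support, ψ y ∈ g y) ∧
      χ = ∑ y ∈ φ.support, φ y • ψ y }

theorem structMap_mapDomain {S M ι : Type*} [Semiring S] [AddCommMonoid M] [Module S M]
    (u : ι → M) (Φ : ι →₀ S) :
    structMap S M (Finsupp.mapDomain u Φ) = Φ.sum fun i s => s • u i :=
  Finsupp.sum_mapDomain_index (fun x => zero_smul S x) (fun x a b => add_smul a b x)

theorem mem_alphaMap_iff {S M : Type*} [Semiring S] [AddCommMonoid M] [Module S M]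
    {Φ : Set M →₀ S} {m : M} :
    m ∈ alphaMap S Φ ↔
      ∃ u : Set M → M, (∀ A ∈ Φ.support, u A ∈ A) ∧ (Φ.sum fun A s => s • u A) = m := by
  constructor
  · rintro ⟨φ, ⟨u, hu, rfl⟩, rfl⟩
    exact ⟨u, hu, (structMap_mapDomain u Φ).symm⟩
  · rintro ⟨u, hu, rfl⟩
    exact ⟨_, ⟨u, hu, rfl⟩, structMap_mapDomain u Φ⟩

theorem sum_smul_mem_convClos {S M ι : Type*} [Semiring S] [AddCommMonoid M] [Module S M]
    {A : Set M} (s : Finset ι) (w : ι → S) (v : ι → M)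
    (hv : ∀ i ∈ s, w i ≠ 0 → v i ∈ A) (hw : ∑ i ∈ s, w i = 1) :
    ∑ i ∈ s, w i • v i ∈ convClos S A := by
  classical
  refine ⟨∑ i ∈ s, Finsupp.single (v i) (w i), ?_, ?_, ?_⟩
  · intro x hx
    have hx' : ∑ i ∈ s, Finsupp.single (v i) (w i) x ≠ 0 := by
      simpa [Finsupp.finsetSum_apply] using hx
    obtain ⟨i, hi, hne⟩ := Finset.exists_ne_zero_of_sum_ne_zero hx'
    obtain ⟨rfl, hwi⟩ := Finsupp.single_apply_ne_zero.mp hne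
    exact hv i hi hwi
  · rw [← Finsupp.sum_finsetSum_index (fun _ => rfl) (fun _ _ _ => rfl), ← hw]
    exact Finset.sum_congr rfl fun i _ => Finsupp.sum_single_index rfl
  · rw [structMap, ← Finsupp.sum_finsetSum_index (fun x => zero_smul S x)
      (fun x a b => add_smul a b x)]
    exact Finset.sum_congr rfl fun i _ => Finsupp.sum_single_index (zero_smul S _)

theorem eq_zero_of_sum_eq_zero_of_positive {S ι : Type*} [AddCommMonoid S]
    (hpos : ∀ a b : S, a + b = 0 → a = 0 ∧ b = 0) {s : Finset ι} {f : ι → S}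
    (h : ∑ i ∈ s, f i = 0) {i : ι} (hi : i ∈ s) : f i = 0 := by
  classical
  rw [← Finset.add_sum_erase s f hi] at h
  exact (hpos _ _ h).1

theorem sum_smul_sum_eq {S M ι : Type*} [Semiring S] [AddCommMonoid M] [Module S M]
    (s : Finset ι) (w : ι → S) (Θ : ι → Set M →₀ S) (u : ι → Set M → M) (T : Finset (Set M))
    (hT : ∀ i ∈ s, w i ≠ 0 → (Θ i).support ⊆ T) :
    ∑ i ∈ s, w i • ((Θ i).sum fun A r => r • u i A)
      = ∑ A ∈ T, ∑ i ∈ s, (w i * Θ i A) • u i A := by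
  rw [Finset.sum_comm]
  refine Finset.sum_congr rfl fun i hi => ?_
  by_cases hwi : w i = 0
  · simp [hwi]
  · rw [Finsupp.sum_of_support_subset _ (hT i hi hwi) (fun A r => r • u i A)
        (fun A _ => zero_smul S _),
      Finset.smul_sum]
    simp [mul_smul]

theorem support_subset_support_sum_smul {S ι κ : Type*} [DivisionSemiring S]
    (hpos : ∀ a b : S, a + b = 0 → a = 0 ∧ b = 0) {s : Finset ι} {w : ι → S} {Θ : ι → κ →₀ S}
    {i : ι} (hi : i ∈ s) (hwi : w i ≠ 0) :
    (Θ i).support ⊆ (∑ j ∈ s, w j • Θ j).support := by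
  intro A hA
  rw [Finsupp.mem_support_iff] at hA ⊢
  intro h
  simp only [Finsupp.finsetSum_apply, Finsupp.smul_apply, smul_eq_mul] at h
  exact mul_ne_zero hwi hA (eq_zero_of_sum_eq_zero_of_positive hpos h hi)

/-- for a finite set `ℬ` of finitely supported functions on `𝒫(𝕊X)`
whose supports consist of convex sets, and `𝒜 = conv(ℬ)`,
`⋃_{Ω ∈ 𝒜} α(Ω) = conv(⋃_{Θ ∈ ℬ} α(Θ))`. -/
theorem iUnion_alphaMap_convClos_finite {S : Type*} [DivisionSemiring S]
    (hpos : ∀ a b : S, a + b = 0 → a = 0 ∧ b = 0)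
    {X : Type u}
    (ℬ : Set ((Set (X →₀ S)) →₀ S)) (hfin : ℬ.Finite)
    (hconv : ∀ Θ ∈ ℬ, ∀ A ∈ Θ.support, IsConvex S A) :
    (⋃ Ω ∈ convClos S ℬ, alphaMap S Ω)
      = convClos S (⋃ Θ ∈ ℬ, alphaMap S Θ) := by
  ext m
  simp only [Set.mem_iUnion, exists_prop]
  constructor
  · rintro ⟨_, ⟨φ, hφ, hφ1, rfl⟩, hm⟩
    obtain ⟨u, hu, rfl⟩ := mem_alphaMap_iff.mp hm
    have hsub : ∀ Θ ∈ φ.support, φ Θ ≠ 0 →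
        Θ.support ⊆ (structMap S (Set (X →₀ S) →₀ S) φ).support :=
      fun Θ hΘ h => support_subset_support_sum_smul hpos (w := φ) (Θ := id) hΘ h
    have key := sum_smul_sum_eq φ.support φ id (fun _ => u) _ hsub
    have hm' : ((structMap S (Set (X →₀ S) →₀ S) φ).sum fun A s => s • u A)
        = ∑ Θ ∈ φ.support, φ Θ • (Θ.sum fun A r => r • u A) := by
      refine Eq.trans (Finset.sum_congr rfl fun A _ => ?_) key.symm
      simp only [structMap, Finsupp.sum, Finsupp.finsetSum_apply, Finsupp.smul_apply,
        smul_eq_mul, Finset.sum_smul, id]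
    rw [hm']
    refine sum_smul_mem_convClos _ _ _ (fun Θ hΘ h => ?_) hφ1
    simp only [Set.mem_iUnion, exists_prop]
    exact ⟨Θ, hφ hΘ, mem_alphaMap_iff.mpr ⟨u, fun A hA => hu A (hsub Θ hΘ h hA), rfl⟩⟩
  · rintro ⟨ψ, hψ, hψ1, rfl⟩
    have hex : ∀ x : X →₀ S, ∃ (Θ : Set (X →₀ S) →₀ S) (u : Set (X →₀ S) → (X →₀ S)),
        x ∈ ψ.support → Θ ∈ ℬ ∧ (∀ A ∈ Θ.support, u A ∈ A) ∧
          (Θ.sum fun A s => s • u A) = x := by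
      intro x
      by_cases hx : x ∈ ψ.support
      · have hx' := hψ hx
        simp only [Set.mem_iUnion, exists_prop] at hx'
        obtain ⟨Θ, hΘ, hxΘ⟩ := hx'
        obtain ⟨u, hu, h⟩ := mem_alphaMap_iff.mp hxΘ
        exact ⟨Θ, u, fun _ => ⟨hΘ, hu, h⟩⟩
      · exact ⟨0, fun _ => 0, fun h => absurd h hx⟩
    choose Θ u h using hex
    set Ω : Set (X →₀ S) →₀ S := ∑ x ∈ ψ.support, ψ x • Θ x with hΩ
    have hΩA : ∀ A, Ω A = ∑ x ∈ ψ.support, ψ x * Θ x A := fun A => by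
      simp [hΩ, Finsupp.finsetSum_apply]
    refine ⟨Ω, sum_smul_mem_convClos _ _ _ (fun x hx _ => (h x hx).1) hψ1,
      mem_alphaMap_iff.mpr ⟨fun A => ∑ x ∈ ψ.support, ((Ω A)⁻¹ * (ψ x * Θ x A)) • u x A,
        fun A hA => ?_, ?_⟩⟩
    · have hA0 : Ω A ≠ 0 := Finsupp.mem_support_iff.mp hA
      have hAconv : IsConvex S A := by
        obtain ⟨x, hx, hne⟩ := Finset.exists_ne_zero_of_sum_ne_zero (hΩA A ▸ hA0)
        exact hconv _ (h x hx).1 A (Finsupp.mem_support_iff.mpr (right_ne_zero_of_mul hne))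
      rw [IsConvex] at hAconv
      have hmem : ∑ x ∈ ψ.support, ((Ω A)⁻¹ * (ψ x * Θ x A)) • u x A ∈ convClos S A := by
        refine sum_smul_mem_convClos _ _ _ (fun x hx hne => (h x hx).2.1 A ?_) ?_
        · exact Finsupp.mem_support_iff.mpr (right_ne_zero_of_mul (right_ne_zero_of_mul hne))
        · rw [← Finset.mul_sum, ← hΩA, inv_mul_cancel₀ hA0]
      rwa [hAconv] at hmem
    · have key := sum_smul_sum_eq ψ.support ψ Θ u Ω.support
        (fun x hx hne => support_subset_support_sum_smul hpos hx hne)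
      have hψm : structMap S (X →₀ S) ψ
          = ∑ x ∈ ψ.support, ψ x • ((Θ x).sum fun A r => r • u x A) :=
        Finset.sum_congr rfl fun x hx => by rw [(h x hx).2.2]
      rw [hψm, key]
      refine Finset.sum_congr rfl fun A hA => ?_
      have hA0 : Ω A ≠ 0 := Finsupp.mem_support_iff.mp hA
      simp only [Finset.smul_sum, smul_smul]
      exact Finset.sum_congr rfl fun x _ => by rw [mul_inv_cancel_left₀ hA0]
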